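/- arXiv:1502.06774 — 2 statements merged into one kernel-verified Lean document; each statement's English description precedes it below -/
import Mathlib

section
/- Let (Ω, F, μ) be a σ-finite measure space, p a density, and u a measurable function with ∫ u p dμ = 0 whose Luxemburg norm satisfies ‖u‖_{Φ,p} = inf{λ > 0 : ∫ (cosh(u/λ) − 1) p dμ ≤ 1} < 1. Then u lies in the proper domain of the cumulant generating functional, i.e. ∫ e^u p dμ < ∞. Consequently the open unit ball of B_p is contained in dom(K_p). -/
open MeasureTheory ENNReal

/-- The Young function `Φ(x) = cosh x − 1`. -/
noncomputable def Phi (x : ℝ) : ℝ := Real.cosh x - 1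

/-- The measure `p·μ` associated to a density `p`. -/
noncomputable def densMeasure {Ω : Type*} [MeasurableSpace Ω] (μ : Measure Ω) (p : Ω → ℝ) :
    Measure Ω := μ.withDensity fun x => ENNReal.ofReal (p x)

/-- The Luxemburg norm of `u`: `inf {λ > 0 : ∫ (cosh(u/λ) − 1) dν ≤ 1}`. -/
noncomputable def luxNorm {Ω : Type*} [MeasurableSpace Ω] (ν : Measure Ω) (u : Ω → ℝ) : ℝ :=
  sInf {l : ℝ | 0 < l ∧ ∫⁻ x, ENNReal.ofReal (Phi (u x / l)) ∂ν ≤ 1}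

lemma Phi_mul_le {t : ℝ} (ht₀ : 0 ≤ t) (ht₁ : t ≤ 1) (y : ℝ) : Phi (t * y) ≤ t * Phi y := by
  have key : ∀ z : ℝ, Real.exp (t * z) ≤ t * Real.exp z + (1 - t) := fun z => by
    simpa using convexOn_exp.2 (Set.mem_univ z) (Set.mem_univ 0) ht₀ (sub_nonneg.2 ht₁)
      (by ring)
  have h₁ := key y
  have h₂ := key (-y)
  rw [mul_neg] at h₂
  simp only [Phi, Real.cosh_eq]
  linarith

lemma Phi_le_Phi_div {l : ℝ} (hl₀ : 0 < l) (hl₁ : l ≤ 1) (y : ℝ) : Phi y ≤ Phi (y / l) := by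
  refine sub_le_sub_right (Real.cosh_le_cosh.2 ?_) 1
  rw [abs_div, abs_of_pos hl₀]
  exact le_div_self (abs_nonneg y) hl₀ hl₁

lemma exp_le_two_mul_Phi_add_two (y : ℝ) : Real.exp y ≤ 2 * Phi y + 2 := by
  have := Real.exp_pos (-y)
  simp only [Phi, Real.cosh_eq]
  linarith

/-- The set defining the Luxemburg norm is nonempty for members of the Orlicz class. -/
lemma luxNorm_set_nonempty {Ω : Type*} [MeasurableSpace Ω] {ν : Measure Ω} {u : Ω → ℝ}
    (hu : ∃ α > (0 : ℝ), ∫⁻ x, ENNReal.ofReal (Phi (α * u x)) ∂ν < ⊤) :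
    {l : ℝ | 0 < l ∧ ∫⁻ x, ENNReal.ofReal (Phi (u x / l)) ∂ν ≤ 1}.Nonempty := by
  obtain ⟨α, hα, hC⟩ := hu
  set C := ∫⁻ x, ENNReal.ofReal (Phi (α * u x)) ∂ν
  have hC₀ : 0 ≤ C.toReal := ENNReal.toReal_nonneg
  set t : ℝ := (1 + C.toReal)⁻¹ with ht
  have ht₀ : 0 < t := by positivity
  have ht₁ : t ≤ 1 := inv_le_one_of_one_le₀ (by linarith)
  refine ⟨(t * α)⁻¹, by positivity, ?_⟩
  calc ∫⁻ x, ENNReal.ofReal (Phi (u x / (t * α)⁻¹)) ∂ν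
      ≤ ∫⁻ x, ENNReal.ofReal t * ENNReal.ofReal (Phi (α * u x)) ∂ν := by
        refine lintegral_mono fun x => ?_
        rw [← ENNReal.ofReal_mul ht₀.le]
        refine ENNReal.ofReal_le_ofReal ?_
        rw [div_inv_eq_mul, mul_comm, mul_assoc]
        exact Phi_mul_le ht₀.le ht₁ _
    _ = ENNReal.ofReal t * C := lintegral_const_mul' _ _ ENNReal.ofReal_ne_top
    _ = ENNReal.ofReal (t * C.toReal) := by
        rw [ENNReal.ofReal_mul ht₀.le, ENNReal.ofReal_toReal hC.ne]
    _ ≤ 1 := by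
        rw [ENNReal.ofReal_le_one, ht, inv_mul_le_iff₀ (by positivity)]
        linarith

/-- if `u ∈ B_p` has Luxemburg norm `< 1` then `u` lies in the proper
domain of the cumulant generating functional, i.e. `∫ e^u p dμ < ∞`.  Consequently
the open unit ball of `B_p` is contained in `dom(K_p)`. -/
theorem unit_ball_subset_dom_cumulant
    {Ω : Type*} [MeasurableSpace Ω] (μ : Measure Ω) [SigmaFinite μ]
    (p : Ω → ℝ) (hp_meas : Measurable p) (hp_pos : ∀ᵐ x ∂μ, 0 < p x)
    (hp_int : ∫⁻ x, ENNReal.ofReal (p x) ∂μ = 1)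
    (u : Ω → ℝ) (hu_meas : Measurable u)
    (hu_mem : ∃ α > (0:ℝ), ∫⁻ x, ENNReal.ofReal (Phi (α * u x)) ∂(densMeasure μ p) < ⊤)
    (hu_int : Integrable u (densMeasure μ p))
    (hu_zero : ∫ x, u x ∂(densMeasure μ p) = 0)
    (hu_norm : luxNorm (densMeasure μ p) u < 1) :
    ∫⁻ x, ENNReal.ofReal (Real.exp (u x)) ∂(densMeasure μ p) < ⊤ := by
  obtain ⟨l, ⟨hl₀, hl⟩, hl₁⟩ := exists_lt_of_csInf_lt (luxNorm_set_nonempty hu_mem) hu_norm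
  have h_univ : densMeasure μ p Set.univ = 1 := by
    rw [densMeasure, withDensity_apply _ MeasurableSet.univ, Measure.restrict_univ, hp_int]
  calc ∫⁻ x, ENNReal.ofReal (Real.exp (u x)) ∂(densMeasure μ p)
      ≤ ∫⁻ x, (2 * ENNReal.ofReal (Phi (u x / l)) + 2) ∂(densMeasure μ p) := by
        refine lintegral_mono fun x => ?_
        have h : Real.exp (u x) ≤ 2 * Phi (u x / l) + 2 := by
          linarith [exp_le_two_mul_Phi_add_two (u x), Phi_le_Phi_div hl₀ hl₁.le (u x)]
        refine (ENNReal.ofReal_le_ofReal h).trans (ENNReal.ofReal_add_le.trans_eq ?_)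
        rw [ENNReal.ofReal_mul zero_le_two, ENNReal.ofReal_ofNat]
    _ = 2 * ∫⁻ x, ENNReal.ofReal (Phi (u x / l)) ∂(densMeasure μ p) + 2 := by
        rw [lintegral_add_right _ measurable_const, lintegral_const_mul' _ _ (by simp),
          lintegral_const, h_univ, mul_one]
    _ ≤ 2 * 1 + 2 := by gcongr
    _ < ⊤ := by simp
end

section
/- There exists a constant C > 0 such that for every continuously differentiable F : ℝ → ℝ with ∫_ℝ Φ_*(F(y)) M₁(y) dy < ∞ and ∫_ℝ Φ_*(F′(y)) M₁(y) dy < ∞, one has the weighted Hardy-type inequality ∫_ℝ Φ_*(y·F(y)) M₁(y) dy ≤ C ∫_ℝ ( Φ_*(F(y)) + Φ_*(F′(y)) ) M₁(y) dy. In particular, multiplication by the coordinate maps the Gaussian Orlicz–Sobolev space W¹_{Φ_*}(M₁) continuously into the Orlicz space L^{Φ_*}(M₁). -/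
open MeasureTheory ENNReal

/-- The conjugate Young function `Φ_*(y) = y·arsinh y + 1 − √(1 + y²)`. -/
noncomputable def PhiStar (y : ℝ) : ℝ := y * Real.arsinh y + 1 - Real.sqrt (1 + y ^ 2)

/-- The one-dimensional standard Gaussian density `M₁(y) = (2π)^{−1/2} e^{−y²/2}`. -/
noncomputable def M1 (y : ℝ) : ℝ := (2 * Real.pi) ^ (-(1 : ℝ) / 2) * Real.exp (-y ^ 2 / 2)

lemma nonneg_of_hasDerivAt_nonneg {f f' : ℝ → ℝ} (hf : ∀ x, HasDerivAt f (f' x) x)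
    (h0 : f 0 = 0) (hf' : ∀ x, 0 ≤ x → 0 ≤ f' x) {x : ℝ} (hx : 0 ≤ x) : 0 ≤ f x := by
  have hmono : MonotoneOn f (Set.Ici 0) := by
    apply monotoneOn_of_deriv_nonneg (convex_Ici 0)
      (fun y _ => (hf y).continuousAt.continuousWithinAt)
      (fun y _ => (hf y).differentiableAt.differentiableWithinAt)
    intro y hy
    rw [interior_Ici] at hy
    rw [(hf y).deriv]
    exact hf' y (le_of_lt hy)
  simpa [h0] using hmono Set.self_mem_Ici hx hx

lemma PhiStar_neg (x : ℝ) : PhiStar (-x) = PhiStar x := by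
  simp [PhiStar, Real.arsinh_neg]

lemma PhiStar_zero : PhiStar 0 = 0 := by simp [PhiStar]

lemma PhiStar_sinh (t : ℝ) : PhiStar (Real.sinh t) = t * Real.sinh t + 1 - Real.cosh t := by
  rw [PhiStar, Real.arsinh_sinh, add_comm 1, ← Real.cosh_sq, Real.sqrt_sq (Real.cosh_pos t).le]
  ring

lemma hasDerivAt_PhiStar (x : ℝ) : HasDerivAt PhiStar (Real.arsinh x) x := by
  have hpos : 0 < 1 + x ^ 2 := by positivity
  have h := (((hasDerivAt_id x).mul (Real.hasDerivAt_arsinh x)).add_const 1).sub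
    ((((hasDerivAt_id x).pow 2).const_add 1).sqrt hpos.ne')
  refine h.congr_deriv ?_
  simp
  field_simp
  ring

lemma cosh_add_sub_mul_sinh_le (a t : ℝ) :
    Real.cosh t + (a - t) * Real.sinh t ≤ Real.cosh a := by
  have h1 := mul_le_mul_of_nonneg_left (Real.add_one_le_exp (a - t)) (Real.exp_pos t).le
  have h2 := mul_le_mul_of_nonneg_left (Real.add_one_le_exp (-(a - t))) (Real.exp_pos (-t)).le
  rw [← Real.exp_add, add_sub_cancel] at h1
  rw [← Real.exp_add, show -t + -(a - t) = -a by ring] at h2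
  rw [Real.cosh_eq, Real.sinh_eq, Real.cosh_eq]
  linarith

lemma mul_le_cosh_sub_one_add_PhiStar (a b : ℝ) : a * b ≤ Real.cosh a - 1 + PhiStar b := by
  rw [← Real.sinh_arsinh b, PhiStar_sinh]
  linarith [cosh_add_sub_mul_sinh_le a (Real.arsinh b)]

lemma PhiStar_nonneg (x : ℝ) : 0 ≤ PhiStar x := by
  simpa using mul_le_cosh_sub_one_add_PhiStar 0 x

lemma two_mul_sqrt_sub_two_le (x : ℝ) : 2 * √(1 + x ^ 2) - 2 ≤ x * Real.arsinh x := by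
  wlog hx : 0 ≤ x generalizing x
  · simpa [Real.arsinh_neg] using this (-x) (by linarith)
  have hs : 0 ≤ Real.arsinh x / 2 := by
    have := Real.arsinh_nonneg_iff.2 hx
    linarith
  have key : 0 ≤ Real.arsinh x / 2 * Real.cosh (Real.arsinh x / 2)
      - Real.sinh (Real.arsinh x / 2) := by
    refine nonneg_of_hasDerivAt_nonneg (f := fun s => s * Real.cosh s - Real.sinh s)
      (f' := fun s => s * Real.sinh s) (fun s => ?_) (by simp) (fun s h => ?_) hs
    · exact (((hasDerivAt_id s).mul (Real.hasDerivAt_cosh s)).sub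
        (Real.hasDerivAt_sinh s)).congr_deriv (by simp)
    · exact mul_nonneg h (Real.sinh_nonneg_iff.2 h)
  have hsinh := Real.sinh_nonneg_iff.2 hs
  obtain ⟨s, hxs⟩ : ∃ s, Real.arsinh x = 2 * s := ⟨Real.arsinh x / 2, by ring⟩
  have hx' : x = Real.sinh (2 * s) := by rw [← hxs, Real.sinh_arsinh]
  rw [← Real.cosh_arsinh, hxs]
  rw [hxs, show 2 * s / 2 = s by ring] at key hsinh
  rw [hx', Real.sinh_two_mul, Real.cosh_two_mul, Real.cosh_sq]
  nlinarith [mul_nonneg hsinh key]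

lemma mul_arsinh_le_two_mul_PhiStar (x : ℝ) : x * Real.arsinh x ≤ 2 * PhiStar x := by
  rw [PhiStar]
  linarith [two_mul_sqrt_sub_two_le x]

lemma PhiStar_mul_le (a x : ℝ) : PhiStar (a * x) ≤ (1 + a ^ 2) * PhiStar x := by
  wlog ha : 0 ≤ a generalizing a
  · simpa [PhiStar_neg] using this (-a) (by linarith)
  wlog hx : 0 ≤ x generalizing x
  · simpa [PhiStar_neg] using this (-x) (by linarith)
  have hlin (y : ℝ) : HasDerivAt (fun y => a * y) a y := by
    simpa using (hasDerivAt_id y).const_mul a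
  suffices 0 ≤ (1 + a ^ 2) * PhiStar x - PhiStar (a * x) by linarith
  refine nonneg_of_hasDerivAt_nonneg (f := fun x => (1 + a ^ 2) * PhiStar x - PhiStar (a * x))
    (f' := fun x => (1 + a ^ 2) * Real.arsinh x - Real.arsinh (a * x) * a)
    (fun y => ?_) (by simp [PhiStar_zero]) (fun y hy => ?_) hx
  · exact ((hasDerivAt_PhiStar y).const_mul _).sub ((hasDerivAt_PhiStar (a * y)).comp y (hlin y))
  refine nonneg_of_hasDerivAt_nonneg
    (f := fun x => (1 + a ^ 2) * Real.arsinh x - Real.arsinh (a * x) * a)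
    (f' := fun x => (1 + a ^ 2) * (√(1 + x ^ 2))⁻¹ - (√(1 + (a * x) ^ 2))⁻¹ * a * a)
    (fun z => ?_) (by simp) (fun z _ => ?_) hy
  · exact ((Real.hasDerivAt_arsinh z).const_mul _).sub
      (((Real.hasDerivAt_arsinh (a * z)).comp z (hlin z)).mul_const a)
  have h1 : 0 < √(1 + z ^ 2) := by positivity
  have h2 : 0 < √(1 + (a * z) ^ 2) := by positivity
  have h3 : a ^ 2 * √(1 + z ^ 2) ≤ (1 + a ^ 2) * √(1 + (a * z) ^ 2) := by
    refine abs_le_of_sq_le_sq' ?_ (by positivity) |>.2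
    rw [mul_pow, mul_pow, Real.sq_sqrt (by positivity), Real.sq_sqrt (by positivity)]
    have : 0 ≤ 1 + 2 * a ^ 2 + (a ^ 2 + a ^ 4 + a ^ 6) * z ^ 2 := by positivity
    nlinarith [this]
  rw [sub_nonneg, ← div_eq_mul_inv, mul_assoc, inv_mul_eq_div, div_le_div_iff₀ h2 h1]
  linarith

lemma arsinh_mul_le (x b : ℝ) :
    Real.arsinh x * b ≤ PhiStar x / 2 + 5 * PhiStar b := by
  have h1 := mul_le_cosh_sub_one_add_PhiStar (Real.arsinh x / 2) (2 * b)
  have h2 := PhiStar_mul_le 2 b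
  have h3 : Real.cosh (Real.arsinh x / 2) - 1 ≤ (√(1 + x ^ 2) - 1) / 2 := by
    have h4 := Real.one_le_cosh (Real.arsinh x / 2)
    have h5 := Real.cosh_two_mul (Real.arsinh x / 2)
    rw [Real.sinh_sq, mul_div_cancel₀ _ (two_ne_zero), Real.cosh_arsinh] at h5
    nlinarith
  have h6 := two_mul_sqrt_sub_two_le x
  have h7 : PhiStar x = x * Real.arsinh x + 1 - √(1 + x ^ 2) := rfl
  linarith

lemma M1_nonneg (y : ℝ) : 0 ≤ M1 y := by
  unfold M1
  positivity

lemma hasDerivAt_M1 (y : ℝ) : HasDerivAt M1 (-y * M1 y) y := by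
  have h := (((hasDerivAt_pow 2 y).neg.div_const 2).exp).const_mul
    ((2 * Real.pi) ^ (-(1 : ℝ) / 2))
  refine h.congr_deriv ?_
  rw [M1]
  simp
  ring

@[fun_prop]
lemma continuous_M1 : Continuous M1 :=
  continuous_iff_continuousAt.2 fun y => (hasDerivAt_M1 y).continuousAt

@[fun_prop]
lemma continuous_PhiStar : Continuous PhiStar :=
  continuous_iff_continuousAt.2 fun y => (hasDerivAt_PhiStar y).continuousAt

/-- The derivative of `y / (1 + y²) · Φ_*(y F(y))` when `F` has value `u` and derivative `v` at `y`. -/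
noncomputable def hardyWeightDeriv (y u v : ℝ) : ℝ :=
  (1 - y ^ 2) / (1 + y ^ 2) ^ 2 * PhiStar (y * u)
    + y / (1 + y ^ 2) * (Real.arsinh (y * u) * (u + y * v))

lemma hasDerivAt_hardyWeight {F : ℝ → ℝ} {v y : ℝ} (hF : HasDerivAt F v y) :
    HasDerivAt (fun y => y / (1 + y ^ 2) * PhiStar (y * F y)) (hardyWeightDeriv y (F y) v) y := by
  have hpos : 1 + y ^ 2 ≠ 0 := by positivity
  have h1 := (hasDerivAt_id y).div ((hasDerivAt_pow 2 y).const_add 1) hpos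
  have h2 := (hasDerivAt_PhiStar (y * F y)).comp y ((hasDerivAt_id y).mul hF)
  refine (h1.mul h2).congr_deriv ?_
  simp only [hardyWeightDeriv, Pi.mul_apply, Pi.div_apply, Function.comp_apply, id]
  push_cast
  ring

lemma PhiStar_mul_le_hardyWeightDeriv (y u v : ℝ) :
    PhiStar (y * u) ≤
      2 * (y * (y / (1 + y ^ 2) * PhiStar (y * u)) - hardyWeightDeriv y u v)
        + 10 * (PhiStar u + PhiStar v) := by
  set q := 1 / (1 + y ^ 2) with hq
  have hq0 : 0 ≤ q := by positivity
  have hqy : q * y ^ 2 = 1 - q := by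
    rw [hq]
    field_simp
    ring
  have hq1 : q ≤ 1 := by nlinarith [mul_nonneg hq0 (sq_nonneg y)]
  have hP := PhiStar_nonneg (y * u)
  have h1 : q * PhiStar (y * u) ≤ PhiStar u := by
    rw [hq, one_div, inv_mul_le_iff₀ (by positivity)]
    exact PhiStar_mul_le y u
  have h2 := mul_le_mul_of_nonneg_left (mul_arsinh_le_two_mul_PhiStar (y * u)) hq0
  have h3 := mul_le_mul_of_nonneg_left (arsinh_mul_le (y * u) v) (sub_nonneg.2 hq1)
  have hH : hardyWeightDeriv y u v = (q ^ 2 - q * (1 - q)) * PhiStar (y * u)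
      + q * (y * u * Real.arsinh (y * u)) + (1 - q) * (Real.arsinh (y * u) * v) := by
    rw [← hqy, hq, hardyWeightDeriv]
    field_simp
    ring
  have hY : y * (y / (1 + y ^ 2) * PhiStar (y * u)) = (1 - q) * PhiStar (y * u) := by
    rw [← hqy, hq]
    ring
  rw [hH, hY]
  have h4 := mul_nonneg hq0 (PhiStar_nonneg v)
  have h5 := mul_le_mul_of_nonneg_right (mul_le_of_le_one_left hq0 hq1) hP
  have h6 := mul_nonneg hq0 hP
  have h7 := PhiStar_nonneg u
  nlinarith

lemma intervalIntegral_PhiStar_mul_le {F : ℝ → ℝ} (hF : ContDiff ℝ 1 F) {R : ℝ} (hR : 0 ≤ R) :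
    ∫ y in (-R)..R, PhiStar (y * F y) * M1 y ≤
      ∫ y in (-R)..R, 10 * ((PhiStar (F y) + PhiStar (deriv F y)) * M1 y) := by
  have hc := hF.continuous
  have hc' : Continuous (deriv F) := hF.continuous_deriv le_rfl
  set H : ℝ → ℝ := fun y => y / (1 + y ^ 2) * PhiStar (y * F y) with hH
  set K : ℝ → ℝ := fun y => hardyWeightDeriv y (F y) (deriv F y) * M1 y + H y * (-y * M1 y)
    with hK
  have hderiv (y : ℝ) : HasDerivAt (fun y => H y * M1 y) (K y) y :=
    (hasDerivAt_hardyWeight (hF.differentiable one_ne_zero y).hasDerivAt).mul (hasDerivAt_M1 y)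
  have hKc : Continuous K := by
    unfold K H hardyWeightDeriv
    have := Real.continuous_arsinh
    fun_prop (disch := intro x; positivity)
  have hrhs : Continuous fun y => 10 * ((PhiStar (F y) + PhiStar (deriv F y)) * M1 y) := by
    fun_prop
  have hftc := intervalIntegral.integral_eq_sub_of_hasDerivAt (a := -R) (b := R)
    (fun y _ => hderiv y) (hKc.intervalIntegrable _ _)
  have hbdry : 0 ≤ ∫ y in (-R)..R, K y := by
    rw [hftc]
    have h1 : 0 ≤ H R * M1 R :=
      mul_nonneg (mul_nonneg (by positivity) (PhiStar_nonneg _)) (M1_nonneg _)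
    have h2 : 0 ≤ -H (-R) * M1 (-R) := by
      refine mul_nonneg ?_ (M1_nonneg _)
      rw [hH, ← neg_mul, ← neg_div, neg_neg]
      exact mul_nonneg (by positivity) (PhiStar_nonneg _)
    linarith
  calc ∫ y in (-R)..R, PhiStar (y * F y) * M1 y
      ≤ ∫ y in (-R)..R, (10 * ((PhiStar (F y) + PhiStar (deriv F y)) * M1 y) - 2 * K y) := by
        refine intervalIntegral.integral_mono_on (by linarith)
          (Continuous.intervalIntegrable (by fun_prop) _ _)
          (Continuous.intervalIntegrable (by fun_prop) _ _) fun y _ => ?_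
        have := mul_le_mul_of_nonneg_right
          (PhiStar_mul_le_hardyWeightDeriv y (F y) (deriv F y)) (M1_nonneg y)
        simp only [hK, hH]
        linarith
    _ ≤ _ := by
        rw [intervalIntegral.integral_sub (hrhs.intervalIntegrable _ _)
          ((hKc.const_mul 2).intervalIntegrable _ _), intervalIntegral.integral_const_mul 2]
        linarith

lemma lintegral_Ioc_eq_ofReal_intervalIntegral {f : ℝ → ℝ} (hf : Continuous f)
    (hf0 : ∀ y, 0 ≤ f y) {a b : ℝ} (hab : a ≤ b) :
    ∫⁻ y in Set.Ioc a b, ENNReal.ofReal (f y) = ENNReal.ofReal (∫ y in a..b, f y) := by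
  rw [intervalIntegral.integral_of_le hab, ofReal_integral_eq_lintegral_ofReal
    (hf.intervalIntegrable a b).1 (Filter.Eventually.of_forall hf0)]

lemma lintegral_ofReal_le_of_intervalIntegral_le {f g : ℝ → ℝ} (hf : Continuous f)
    (hg : Continuous g) (hf0 : ∀ y, 0 ≤ f y) (hg0 : ∀ y, 0 ≤ g y)
    (h : ∀ R, 0 ≤ R → ∫ y in (-R)..R, f y ≤ ∫ y in (-R)..R, g y) :
    ∫⁻ y, ENNReal.ofReal (f y) ≤ ∫⁻ y, ENNReal.ofReal (g y) := by
  have hcover : AECover (volume : Measure ℝ) Filter.atTop fun R : ℝ => Set.Ioc (-R) R :=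
    aecover_Ioc Filter.tendsto_neg_atTop_atBot Filter.tendsto_id
  refine le_of_tendsto (hcover.lintegral_tendsto_of_countably_generated
    hf.measurable.ennreal_ofReal.aemeasurable) ?_
  filter_upwards [Filter.eventually_ge_atTop 0] with R hR
  have hab : -R ≤ R := by linarith
  calc ∫⁻ y in Set.Ioc (-R) R, ENNReal.ofReal (f y)
      ≤ ∫⁻ y in Set.Ioc (-R) R, ENNReal.ofReal (g y) := by
        rw [lintegral_Ioc_eq_ofReal_intervalIntegral hf hf0 hab,
          lintegral_Ioc_eq_ofReal_intervalIntegral hg hg0 hab]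
        exact ENNReal.ofReal_le_ofReal (h R hR)
    _ ≤ _ := setLIntegral_le_lintegral _ _

/-- there is a constant `C > 0` such that for every `C¹` function `F` with
`∫ Φ_*(F) M₁ < ∞` and `∫ Φ_*(F′) M₁ < ∞`, the weighted Hardy-type inequality
`∫ Φ_*(y·F(y)) M₁(y) dy ≤ C ∫ (Φ_*(F) + Φ_*(F′)) M₁ dy` holds; in particular
multiplication by the coordinate maps `W¹_{Φ_*}(M₁)` continuously into `L^{Φ_*}(M₁)`. -/
theorem gaussian_orlicz_hardy_inequality :
    ∃ C > (0:ℝ), ∀ F : ℝ → ℝ, ContDiff ℝ 1 F →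
      ∫⁻ y, ENNReal.ofReal (PhiStar (F y) * M1 y) ∂(volume : Measure ℝ) < ⊤ →
      ∫⁻ y, ENNReal.ofReal (PhiStar (deriv F y) * M1 y) ∂(volume : Measure ℝ) < ⊤ →
      ∫⁻ y, ENNReal.ofReal (PhiStar (y * F y) * M1 y) ∂(volume : Measure ℝ) ≤
        ENNReal.ofReal C *
          ∫⁻ y, ENNReal.ofReal ((PhiStar (F y) + PhiStar (deriv F y)) * M1 y)
            ∂(volume : Measure ℝ) := by
  refine ⟨10, by norm_num, fun F hF _ _ => ?_⟩
  have hc := hF.continuous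
  have hc' : Continuous (deriv F) := hF.continuous_deriv le_rfl
  have hnonneg (y : ℝ) : 0 ≤ (PhiStar (F y) + PhiStar (deriv F y)) * M1 y :=
    mul_nonneg (add_nonneg (PhiStar_nonneg _) (PhiStar_nonneg _)) (M1_nonneg y)
  rw [← lintegral_const_mul' _ _ ENNReal.ofReal_ne_top]
  simp_rw [← ENNReal.ofReal_mul (show (0 : ℝ) ≤ 10 by norm_num)]
  exact lintegral_ofReal_le_of_intervalIntegral_le (by fun_prop) (by fun_prop)
    (fun y => mul_nonneg (PhiStar_nonneg _) (M1_nonneg y))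
    (fun y => mul_nonneg (by norm_num) (hnonneg y))
    (fun R hR => intervalIntegral_PhiStar_mul_le hF hR)
end
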